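/- arXiv:2202.09157 — 8 statements merged into one kernel-verified Lean document; each statement's English description precedes it below -/
import Mathlib

section
/- Let m ≤ n, let A be an m×n integer matrix, and let U be an n×n integer matrix with det U = ±1 (unimodular). Write U = [D | C], where D consists of the first n−m columns of U, and assume A·D = 0 (the m×(n−m) zero matrix). If A has full row rank (its rank over ℚ equals m), then the integer kernel ker_ℤ(A) := { x ∈ ℤⁿ : A x = 0 } equals the lattice generated by the columns of D, i.e. ker_ℤ(A) = { D z : z ∈ ℤ^{n−m} }. -/
theorem aux_split {R : Type*} [CommRing R] (m n : ℕ) (hmn : m ≤ n)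
    (U : Matrix (Fin n) (Fin n) R)
    (D : Matrix (Fin n) (Fin (n - m)) R) (C : Matrix (Fin n) (Fin m) R)
    (hD : ∀ (i : Fin n) (j : Fin (n - m)), D i j = U i (Fin.castLE (Nat.sub_le n m) j))
    (p : Fin m → Fin n) (hp : ∀ j, (p j : ℕ) = n - m + (j : ℕ))
    (hC : ∀ (i : Fin n) (j : Fin m), C i j = U i (p j))
    (hU : IsUnit U.det) (x : Fin n → R) :
    ∃ z y, x = D.mulVec z + C.mulVec y := by
  let w := U⁻¹.mulVec x
  have hx : x = U.mulVec w := by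
    simp [w, Matrix.mulVec_mulVec, Matrix.mul_nonsing_inv U hU]
  refine ⟨fun j => w (Fin.castLE (Nat.sub_le n m) j),
    fun j => w (p j), ?_⟩
  rw [hx]
  ext i
  have hn : n - m + m = n := by omega
  simp only [Matrix.mulVec, dotProduct, Pi.add_apply, hD, hC]
  rw [← Equiv.sum_comp (finSumFinEquiv.trans (finCongr hn)), Fintype.sum_sum_type]
  have hp' : ∀ j, p j = (finSumFinEquiv.trans (finCongr hn)) (Sum.inr j) := by
    intro j
    ext
    simp [hp]
  simp only [hp']
  congr 1

/-- Theorem 3.1(a) of the paper.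
Let `m ≤ n`, `A` an `m × n` integer matrix, `U` an `n × n` unimodular integer matrix
partitioned as `U = [D | C]` with `D` its first `n - m` columns, and assume `A * D = 0`.
If `A` has full row rank over `ℚ`, then the integer kernel of `A` is exactly the lattice
generated by the columns of `D`. -/
theorem subsetSum_kernel_lattice_eq
    (m n : ℕ) (hmn : m ≤ n)
    (A : Matrix (Fin m) (Fin n) ℤ) (U : Matrix (Fin n) (Fin n) ℤ)
    (hU : U.det = 1 ∨ U.det = -1)
    (D : Matrix (Fin n) (Fin (n - m)) ℤ) (C : Matrix (Fin n) (Fin m) ℤ)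
    (hD : ∀ (i : Fin n) (j : Fin (n - m)), D i j = U i (Fin.castLE (Nat.sub_le n m) j))
    (hC : ∀ (i : Fin n) (j : Fin m), C i j = U i ⟨n - m + (j : ℕ), by have := j.isLt; omega⟩)
    (hAD : A * D = 0)
    (hrank : (A.map ((↑) : ℤ → ℚ)).rank = m) :
    {x : Fin n → ℤ | A.mulVec x = 0} =
      {y : Fin n → ℤ | ∃ z : Fin (n - m) → ℤ, y = D.mulVec z} := by
  have hUu : IsUnit U.det := by
    rcases hU with h | h <;> simp [h]
  ext x
  simp only [Set.mem_ofPred_eq]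
  constructor
  · intro hx
    obtain ⟨z, y, rfl⟩ := aux_split m n hmn U D C hD _ (fun _ => rfl) hC hUu x
    have hE : (A * C).mulVec y = 0 := by
      rw [Matrix.mulVec_add, Matrix.mulVec_mulVec, Matrix.mulVec_mulVec, hAD] at hx
      simpa using hx
    let f : ℤ →+* ℚ := Int.castRingHom ℚ
    have hAf : (A.map f).rank = m := hrank
    have hAD' : A.map f * D.map f = 0 := by
      rw [← Matrix.map_mul, hAD]; simp
    have hUf : IsUnit (U.map f).det := by
      have := hUu.map f
      rwa [RingHom.map_det] at this
    have htop : LinearMap.range (A.map f).mulVecLin = ⊤ := by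
      apply Submodule.eq_top_of_finrank_eq
      rw [← Matrix.rank, hAf]; simp
    have hsurj : Function.Surjective ((A * C).map f).mulVec := by
      intro b
      obtain ⟨v, hv⟩ := LinearMap.range_eq_top.mp htop b
      obtain ⟨z', y', rfl⟩ := aux_split m n hmn (U.map f) (D.map f) (C.map f)
        (fun i j => by simp [hD]) _ (fun _ => rfl) (fun i j => by rw [Matrix.map_apply, Matrix.map_apply, hC]) hUf v
      refine ⟨y', ?_⟩
      rw [← hv, Matrix.mulVecLin_apply, Matrix.mulVec_add, Matrix.mulVec_mulVec,
        Matrix.mulVec_mulVec, hAD', Matrix.map_mul]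
      simp
    have hinj := Matrix.mulVec_injective_iff_isUnit.mpr
      (Matrix.mulVec_surjective_iff_isUnit.mp hsurj)
    have hy : y = 0 := by
      have h0 : (f ∘ y) = 0 := by
        apply hinj
        ext i
        have := congrArg f (congrFun hE i)
        rw [RingHom.map_mulVec] at this
        simpa using this
      ext i
      have := congrFun h0 i
      simpa [f] using this
    exact ⟨z, by simp [hy]⟩
  · rintro ⟨z, rfl⟩
    rw [Matrix.mulVec_mulVec, hAD, Matrix.zero_mulVec]
end

section
/- Let m ≤ n, let A be an m×n integer matrix, and let U be an n×n integer matrix with det U = ±1 (unimodular). Write U = [D | C], where D consists of the first n−m columns of U and C of the last m columns, and assume A·D = 0. Set E := A·C. Then E is invertible over ℚ (equivalently det E ≠ 0) if and only if A has full row rank (its rank over ℚ equals m). -/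
/-- Theorem 3.1(b) of the paper.
With `U = [D | C]` unimodular, `A * D = 0`, and `E := A * C`, the matrix `E` is invertible
over `ℚ` (equivalently `det E ≠ 0`) if and only if `A` has full row rank over `ℚ`. -/
theorem det_E_ne_zero_iff_full_row_rank
    (m n : ℕ) (hmn : m ≤ n)
    (A : Matrix (Fin m) (Fin n) ℤ) (U : Matrix (Fin n) (Fin n) ℤ)
    (hU : U.det = 1 ∨ U.det = -1)
    (D : Matrix (Fin n) (Fin (n - m)) ℤ) (C : Matrix (Fin n) (Fin m) ℤ)
    (hD : ∀ (i : Fin n) (j : Fin (n - m)), D i j = U i (Fin.castLE (Nat.sub_le n m) j))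
    (hC : ∀ (i : Fin n) (j : Fin m), C i j = U i ⟨n - m + (j : ℕ), by have := j.isLt; omega⟩)
    (hAD : A * D = 0)
    (E : Matrix (Fin m) (Fin m) ℤ) (hE : E = A * C) :
    ((E.map ((↑) : ℤ → ℚ)).det ≠ 0) ↔ (A.map ((↑) : ℤ → ℚ)).rank = m := by
  set Aq := A.map ((↑) : ℤ → ℚ) with hAq
  set Uq := U.map ((↑) : ℤ → ℚ) with hUq
  set Eq := E.map ((↑) : ℤ → ℚ) with hEq
  have hUdet : Uq.det ≠ 0 := by
    have h : Uq.det = ((U.det : ℤ) : ℚ) := by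
      rw [Int.cast_det]
    rw [h]
    rcases hU with h | h <;> simp [h]
  have hlow : ∀ (i : Fin m) (j : Fin (n - m)),
      (Aq * Uq) i (Fin.castLE (Nat.sub_le n m) j) = 0 := by
    intro i j
    have h := congrFun (congrFun hAD i) j
    simp only [Matrix.mul_apply, hD, Matrix.zero_apply] at h
    simp only [hAq, hUq, Matrix.mul_apply, Matrix.map_apply]
    exact_mod_cast h
  have hhigh : ∀ (i : Fin m) (j : Fin m),
      (Aq * Uq) i ⟨n - m + (j : ℕ), by have := j.isLt; omega⟩ = Eq i j := by
    intro i j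
    simp only [hAq, hUq, hEq, hE, Matrix.mul_apply, Matrix.map_apply, hC]
    push_cast
    rfl
  have key : ∀ v : Fin m → ℚ, Matrix.vecMul v Eq = 0 ↔ Matrix.vecMul v Aq = 0 := by
    intro v
    have h1 : Matrix.vecMul v Aq = 0 ↔ Matrix.vecMul v (Aq * Uq) = 0 := by
      rw [← Matrix.vecMul_vecMul]
      constructor
      · intro h
        rw [h, Matrix.zero_vecMul]
      · intro h
        exact Matrix.eq_zero_of_vecMul_eq_zero hUdet h
    rw [h1]
    constructor
    · intro h
      funext k
      by_cases hk : (k : ℕ) < n - m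
      · have hk' : k = Fin.castLE (Nat.sub_le n m) ⟨k, hk⟩ := rfl
        rw [hk']
        simp only [Matrix.vecMul, dotProduct, hlow]
        simp
      · have hlt := k.isLt
        have hj : (k : ℕ) - (n - m) < m := by omega
        have hk' : k = ⟨n - m + ((⟨(k : ℕ) - (n - m), hj⟩ : Fin m) : ℕ), by
            simp only; omega⟩ := by
          apply Fin.ext
          simp only
          omega
        rw [hk']
        have h2 := congrFun h ⟨(k : ℕ) - (n - m), hj⟩
        simp only [Matrix.vecMul, dotProduct] at h2 ⊢
        simp only [hhigh _ ⟨(k : ℕ) - (n - m), hj⟩]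
        exact h2
    · intro h
      funext j
      have h2 := congrFun h ⟨n - m + (j : ℕ), by have := j.isLt; omega⟩
      simp only [Matrix.vecMul, dotProduct, hhigh] at h2 ⊢
      exact h2
  have hrank : Aq.rank = m ↔ ∀ v : Fin m → ℚ, Matrix.vecMul v Aq = 0 → v = 0 := by
    have h1 : Aq.rank = m ↔ LinearIndependent ℚ Aq.row := by
      rw [linearIndependent_iff_card_eq_finrank_span, Matrix.rank_eq_finrank_span_row,
        Fintype.card_fin, Set.finrank, eq_comm]
    rw [h1, ← Matrix.vecMul_injective_iff]
    exact injective_iff_map_eq_zero (Matrix.vecMulLinear Aq)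
  rw [hrank, Ne, ← Matrix.exists_vecMul_eq_zero_iff]
  constructor
  · intro h v hv
    by_contra hne
    exact h ⟨v, hne, (key v).2 hv⟩
  · rintro h ⟨v, hne, hv⟩
    exact hne (h v ((key v).1 hv))
end

section
/- Let m ≤ n, let A be an m×n integer matrix of full row rank (rank over ℚ equals m), and let U be an n×n integer matrix with det U = ±1. Write U = [D | C], where D consists of the first n−m columns of U and C of the last m columns, assume A·D = 0, and set E := A·C (which is then invertible over ℚ). For b ∈ ℤ^m: the system A x = b has a solution x ∈ ℤⁿ if and only if the rational vector E⁻¹ b has all entries in ℤ; moreover, when E⁻¹ b ∈ ℤ^m, the vector x_b := C·(E⁻¹ b) is an integer solution of A x = b. -/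
/-- The rational matrix `E = A * C` of Theorem 3.1 of the paper. -/
noncomputable def Emat (m n : ℕ) (A : Matrix (Fin m) (Fin n) ℤ)
    (C : Matrix (Fin n) (Fin m) ℤ) : Matrix (Fin m) (Fin m) ℚ :=
  (A * C).map ((↑) : ℤ → ℚ)

/-- The rational vector `E⁻¹ b` of Theorem 3.1 of the paper. -/
noncomputable def EinvB (m n : ℕ) (A : Matrix (Fin m) (Fin n) ℤ)
    (C : Matrix (Fin n) (Fin m) ℤ) (b : Fin m → ℤ) : Fin m → ℚ :=
  (Emat m n A C)⁻¹.mulVec fun i => (b i : ℚ)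

/-- Theorem 3.1(c),(d) of the paper.
With `U = [D | C]` unimodular, `A * D = 0`, `A` of full row rank over `ℚ`, and `E := A * C`:
the system `A x = b` has an integer solution iff `E⁻¹ b` has all entries in `ℤ`; and in that
case `x_b := C · (E⁻¹ b)` is an integer solution of `A x = b`. -/
theorem integer_solution_iff_EinvB_integral
    (m n : ℕ) (hmn : m ≤ n)
    (A : Matrix (Fin m) (Fin n) ℤ) (U : Matrix (Fin n) (Fin n) ℤ)
    (hU : U.det = 1 ∨ U.det = -1)
    (D : Matrix (Fin n) (Fin (n - m)) ℤ) (C : Matrix (Fin n) (Fin m) ℤ)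
    (hD : ∀ (i : Fin n) (j : Fin (n - m)), D i j = U i (Fin.castLE (Nat.sub_le n m) j))
    (hC : ∀ (i : Fin n) (j : Fin m), C i j = U i ⟨n - m + (j : ℕ), by have := j.isLt; omega⟩)
    (hAD : A * D = 0)
    (hrank : (A.map ((↑) : ℤ → ℚ)).rank = m)
    (b : Fin m → ℤ) :
    ((∃ x : Fin n → ℤ, A.mulVec x = b) ↔
        ∀ i, ∃ z : ℤ, EinvB m n A C b i = (z : ℚ)) ∧
    ((∀ i, ∃ z : ℤ, EinvB m n A C b i = (z : ℚ)) →
      (∀ i, ∃ z : ℤ, (C.map ((↑) : ℤ → ℚ)).mulVec (EinvB m n A C b) i = (z : ℚ)) ∧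
      (A.map ((↑) : ℤ → ℚ)).mulVec ((C.map ((↑) : ℤ → ℚ)).mulVec (EinvB m n A C b)) =
        fun i => (b i : ℚ)) := by
  have hdet : IsUnit U.det := by
    rcases hU with h | h <;> rw [h] <;> simp
  obtain ⟨P, hP⟩ : ∃ P : Matrix (Fin m) (Fin n) ℤ, A = (A * C) * P := by
    refine ⟨Matrix.of fun j k => U⁻¹ ⟨n - m + (j : ℕ), by have := j.isLt; omega⟩ k, ?_⟩
    have h1 : A = (A * U) * U⁻¹ := by
      rw [Matrix.mul_assoc, Matrix.mul_nonsing_inv _ hdet, Matrix.mul_one]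
    let e : Fin (n - m) ⊕ Fin m ≃ Fin n := finSumFinEquiv.trans (finCongr (by omega))
    have hl : ∀ j, e (Sum.inl j) = Fin.castLE (Nat.sub_le n m) j := by
      intro j; ext; simp [e]
    have hr : ∀ j : Fin m, e (Sum.inr j) = ⟨n - m + (j : ℕ), by have := j.isLt; omega⟩ := by
      intro j; ext; simp [e]
    have hAl : ∀ i j, (A * U) i (e (Sum.inl j)) = 0 := by
      intro i j
      have := congrFun (congrFun hAD i) j
      simpa [Matrix.mul_apply, hD, hl] using this
    have hAr : ∀ i j, (A * U) i (e (Sum.inr j)) = (A * C) i j := by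
      intro i j
      simp [Matrix.mul_apply, hC, hr]
    ext i k
    conv_lhs => rw [h1]
    rw [Matrix.mul_apply, Matrix.mul_apply, ← e.sum_comp, Fintype.sum_sum_type]
    simp only [hAl, hAr, Matrix.of_apply, zero_mul, Finset.sum_const_zero, zero_add]
    simp only [hr]
  have hAQ : A.map ((↑) : ℤ → ℚ) = Emat m n A C * P.map ((↑) : ℤ → ℚ) := by
    conv_lhs => rw [hP]
    exact Matrix.map_mul (f := Int.castRingHom ℚ)
  have hEQ : Emat m n A C = A.map ((↑) : ℤ → ℚ) * C.map ((↑) : ℤ → ℚ) :=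
    Matrix.map_mul (f := Int.castRingHom ℚ)
  have hcast : ∀ {p q : ℕ} (M : Matrix (Fin p) (Fin q) ℤ) (v : Fin q → ℤ),
      (M.map ((↑) : ℤ → ℚ)).mulVec (fun i => (v i : ℚ)) = fun i => ((M.mulVec v i : ℤ) : ℚ) := by
    intro p q M v
    ext i
    simp [Matrix.mulVec, dotProduct]
  have hEu : IsUnit (Emat m n A C) := by
    have h1 : m ≤ (Emat m n A C).rank := by
      have h2 := Matrix.rank_mul_le_left (Emat m n A C) (P.map ((↑) : ℤ → ℚ))
      rwa [← hAQ, hrank] at h2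
    have h3 : (Emat m n A C).mulVecLin.range = ⊤ := by
      apply Submodule.eq_top_of_finrank_eq
      have h4 := (Emat m n A C).rank_le_width
      rw [Module.finrank_fin_fun]
      exact le_antisymm h4 h1
    exact Matrix.mulVec_surjective_iff_isUnit.1 (LinearMap.range_eq_top.1 h3)
  have hEd : IsUnit (Emat m n A C).det := (Matrix.isUnit_iff_isUnit_det _).1 hEu
  have hsol : (A.map ((↑) : ℤ → ℚ)).mulVec ((C.map ((↑) : ℤ → ℚ)).mulVec (EinvB m n A C b)) =
        fun i => (b i : ℚ) := by
    rw [Matrix.mulVec_mulVec, ← hEQ, EinvB, Matrix.mulVec_mulVec,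
      Matrix.mul_nonsing_inv _ hEd, Matrix.one_mulVec]
  have hint : (∀ i, ∃ z : ℤ, EinvB m n A C b i = (z : ℚ)) →
      ∃ y : Fin m → ℤ, EinvB m n A C b = fun i => (y i : ℚ) := by
    intro h
    choose y hy using h
    exact ⟨y, funext hy⟩
  refine ⟨⟨?_, ?_⟩, ?_⟩
  · rintro ⟨x, rfl⟩ i
    refine ⟨P.mulVec x i, ?_⟩
    rw [EinvB, ← hcast, hAQ, Matrix.mulVec_mulVec, ← Matrix.mul_assoc,
      Matrix.nonsing_inv_mul _ hEd, Matrix.one_mul, hcast]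
  · intro h
    obtain ⟨y, hy⟩ := hint h
    refine ⟨C.mulVec y, ?_⟩
    rw [hy, hcast, hcast] at hsol
    ext i
    exact_mod_cast congrFun hsol i
  · intro h
    refine ⟨?_, hsol⟩
    obtain ⟨y, hy⟩ := hint h
    intro i
    exact ⟨C.mulVec y i, by rw [hy, hcast]⟩
end

section
/- Fix n ≥ 1, positive integers a_1,…,a_n and an integer b, and let x ∈ {0,1}ⁿ satisfy Σ_{i=1}^n a_i x_i = b. Let t, M be positive integers with t < M, and set c_i := (t a_i) mod M and d := (t b) mod M (residues in {0,…,M−1}). Then M divides Σ_{i=1}^n c_i x_i − d, the integer k := (Σ_{i=1}^n c_i x_i − d)/M satisfies k ≥ 0, and Σ_{i=1}^n ⌊(t/M) a_i⌋ x_i = ⌊(t/M) b⌋ − k. -/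
/-- equations (13)–(14) of the paper, plus `k ≥ 0`.
Let `x ∈ {0,1}ⁿ` solve the subset-sum problem `∑ aᵢ xᵢ = b`, let `0 < t < M`, and set
`cᵢ := (t aᵢ) mod M`, `d := (t b) mod M`. Then `M ∣ ∑ cᵢ xᵢ − d`, the integer
`k := (∑ cᵢ xᵢ − d)/M` is nonnegative, and `∑ ⌊(t/M) aᵢ⌋ xᵢ = ⌊(t/M) b⌋ − k`. -/
theorem modular_disaggregation_identities
    (n : ℕ) (hn : 1 ≤ n) (a : Fin n → ℤ) (ha : ∀ i, 0 < a i) (b : ℤ)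
    (x : Fin n → ℤ) (hx : ∀ i, x i = 0 ∨ x i = 1)
    (hsol : ∑ i, a i * x i = b)
    (t M : ℤ) (ht : 0 < t) (htM : t < M) :
    M ∣ (∑ i, (t * a i) % M * x i - (t * b) % M) ∧
    0 ≤ (∑ i, (t * a i) % M * x i - (t * b) % M) / M ∧
    ∑ i, ⌊(t : ℚ) / (M : ℚ) * (a i : ℚ)⌋ * x i =
      ⌊(t : ℚ) / (M : ℚ) * (b : ℚ)⌋ -
        (∑ i, (t * a i) % M * x i - (t * b) % M) / M := by
  have hM : 0 < M := ht.trans htM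
  have hfl : ∀ z : ℤ, ⌊(t : ℚ) / (M : ℚ) * (z : ℚ)⌋ = (t * z) / M := by
    intro z
    have hMq : (0 : ℚ) < (M : ℚ) := by exact_mod_cast hM
    have e : (t : ℚ) / (M : ℚ) * (z : ℚ) = ((t * z : ℤ) : ℚ) / (M : ℚ) := by
      push_cast; ring
    have h1 := Int.mul_ediv_add_emod (t * z) M
    have h2 := Int.emod_nonneg (t * z) hM.ne'
    have h3 := Int.emod_lt_of_pos (t * z) hM
    rw [e, Int.floor_eq_iff, le_div_iff₀ hMq, div_lt_iff₀ hMq]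
    constructor
    · have : t * z / M * M ≤ t * z := by linarith
      exact_mod_cast this
    · have : t * z < (t * z / M + 1) * M := by linarith
      exact_mod_cast this
  have key : ∑ i, (t * a i) % M * x i - (t * b) % M
      = M * ((t * b) / M - ∑ i, (t * a i) / M * x i) := by
    have hS : ∑ i, (t * a i) % M * x i = t * b - M * ∑ i, (t * a i) / M * x i := by
      rw [← hsol, Finset.mul_sum, Finset.mul_sum, ← Finset.sum_sub_distrib]
      refine Finset.sum_congr rfl fun i _ => ?_
      rw [Int.emod_def]; ring
    rw [hS, Int.emod_def]; ring
  have hS0 : 0 ≤ ∑ i, (t * a i) % M * x i := by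
    refine Finset.sum_nonneg fun i _ => mul_nonneg (Int.emod_nonneg _ hM.ne') ?_
    rcases hx i with h | h <;> simp [h]
  have hd := Int.emod_lt_of_pos (t * b) hM
  simp only [hfl]
  rw [key, Int.mul_ediv_cancel_left _ hM.ne']
  refine ⟨dvd_mul_right _ _, ?_, by ring⟩
  by_contra hneg
  push Not at hneg
  have : (t * b) / M - ∑ i, (t * a i) / M * x i ≤ -1 := by omega
  nlinarith
end

section
/- Fix n ≥ 1, positive integers a_1,…,a_n and an integer b, and let x ∈ {0,1}ⁿ satisfy Σ_{i=1}^n a_i x_i = b. Let t, M be positive integers with t < M, set c_i := (t a_i) mod M, d := (t b) mod M (residues in {0,…,M−1}), and let k := (Σ_{i=1}^n c_i x_i − d)/M (an integer). Then, with b̃ := Σ_{i=1}^n a_i − b, one has k ≤ u_k(t/M) := ⌊(t/M) b̃⌋ + ⌊(t/M) b⌋ − Σ_{i=1}^n ⌊(t/M) a_i⌋. -/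
theorem floor_aux (t M z : ℤ) (hM : 0 < M) :
    ⌊(t : ℚ) / (M : ℚ) * (z : ℚ)⌋ = (t * z) / M := by
  have hM' : (0 : ℚ) < M := by exact_mod_cast hM
  have h1 := Int.mul_ediv_add_emod (t * z) M
  have h2 := Int.emod_nonneg (t * z) hM.ne'
  have h3 := Int.emod_lt_of_pos (t * z) hM
  have e : (t : ℚ) / (M : ℚ) * (z : ℚ) = ((t * z : ℤ) : ℚ) / M := by
    push_cast; ring
  rw [e, Int.floor_eq_iff, le_div_iff₀ hM', div_lt_iff₀ hM']
  constructor
  · have : (t * z) / M * M ≤ t * z := by linarith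
    exact_mod_cast this
  · have : t * z < ((t * z) / M + 1) * M := by linarith
    exact_mod_cast this

/-- Theorem 3.4 of the paper.
Let `x ∈ {0,1}ⁿ` solve the subset-sum problem `∑ aᵢ xᵢ = b`, let `0 < t < M`, set
`cᵢ := (t aᵢ) mod M`, `d := (t b) mod M` and `k := (∑ cᵢ xᵢ − d)/M`. Then with
`b̃ := ∑ aᵢ − b` one has `k ≤ u_k(t/M) = ⌊(t/M) b̃⌋ + ⌊(t/M) b⌋ − ∑ ⌊(t/M) aᵢ⌋`. -/
theorem slack_le_uk
    (n : ℕ) (hn : 1 ≤ n) (a : Fin n → ℤ) (ha : ∀ i, 0 < a i) (b : ℤ)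
    (x : Fin n → ℤ) (hx : ∀ i, x i = 0 ∨ x i = 1)
    (hsol : ∑ i, a i * x i = b)
    (t M : ℤ) (ht : 0 < t) (htM : t < M) :
    (∑ i, (t * a i) % M * x i - (t * b) % M) / M ≤
      ⌊(t : ℚ) / (M : ℚ) * (((∑ i, a i) - b : ℤ) : ℚ)⌋ +
        ⌊(t : ℚ) / (M : ℚ) * (b : ℚ)⌋ -
          ∑ i, ⌊(t : ℚ) / (M : ℚ) * (a i : ℚ)⌋ := by
  have hM : 0 < M := ht.trans htM
  simp only [floor_aux _ _ _ hM]
  have h1 : ∑ i, (t * a i) % M * x i - (t * b) % M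
      = M * ((t * b) / M - ∑ i, (t * a i) / M * x i) := by
    have e : ∀ i, (t * a i) % M * x i = t * (a i * x i) - M * ((t * a i) / M * x i) := by
      intro i
      rw [Int.emod_def]; ring
    simp only [e]
    rw [Finset.sum_sub_distrib, ← Finset.mul_sum, ← Finset.mul_sum, hsol, Int.emod_def]
    ring
  rw [h1, Int.mul_ediv_cancel_left _ hM.ne']
  have h2 : ∑ i, (t * a i) / M - ∑ i, (t * a i) / M * x i ≤ (t * ((∑ i, a i) - b)) / M := by
    rw [Int.le_ediv_iff_mul_le hM, ← hsol, ← Finset.sum_sub_distrib, ← Finset.sum_sub_distrib,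
      Finset.sum_mul, Finset.mul_sum]
    refine Finset.sum_le_sum fun i _ => ?_
    have := Int.ediv_mul_le (t * a i) hM.ne'
    rcases hx i with h | h <;> rw [h] <;> simp [this]
  linarith
end

section
/- Fix n ≥ 1, positive integers a_1,…,a_n and an integer b, and suppose there exists a binary solution x ∈ {0,1}ⁿ with Σ_{i=1}^n a_i x_i = b. Let t, M be positive integers with t < M, set c_i := (t a_i) mod M, d := (t b) mod M (residues in {0,…,M−1}), b̃ := Σ_{i=1}^n a_i − b, g := (Σ_{i=1}^n c_i − d)/M ∈ ℚ, and u_k(t/M) := ⌊(t/M) b̃⌋ + ⌊(t/M) b⌋ − Σ_{i=1}^n ⌊(t/M) a_i⌋. Then ⌊g⌋ = u_k(t/M), and the following three statements are pairwise equivalent: (a) Σ_{i=1}^n c_i < M + d; (b) g < 1; (c) u_k(t/M) = 0. -/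
theorem floor_div_aux (z M : ℤ) (hM : 0 < M) : ⌊(z : ℚ) / (M : ℚ)⌋ = z / M := by
  have hq : (0 : ℚ) < (M : ℚ) := by exact_mod_cast hM
  have h1 := Int.mul_ediv_add_emod z M
  have h2 := Int.emod_nonneg z hM.ne'
  have h3 := Int.emod_lt_of_pos z hM
  rw [Int.floor_eq_iff, le_div_iff₀ hq, div_lt_iff₀ hq]
  constructor
  · have : z / M * M ≤ z := by linarith [mul_comm M (z / M)]
    exact_mod_cast this
  · have : z < (z / M + 1) * M := by linarith [mul_comm M (z / M)]
    exact_mod_cast this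

theorem floor_mul_aux (t z M : ℤ) (hM : 0 < M) :
    ⌊(t : ℚ) / (M : ℚ) * (z : ℚ)⌋ = (t * z) / M := by
  rw [← floor_div_aux _ _ hM]
  congr 1
  push_cast
  ring

/-- Theorem 3.7 of the paper, together with identity (20).
Suppose the subset-sum problem `∑ aᵢ xᵢ = b` has a binary solution, let `0 < t < M`, set
`cᵢ := (t aᵢ) mod M`, `d := (t b) mod M`, `b̃ := ∑ aᵢ − b`, `g := (∑ cᵢ − d)/M ∈ ℚ`, and
`u_k := ⌊(t/M) b̃⌋ + ⌊(t/M) b⌋ − ∑ ⌊(t/M) aᵢ⌋`. Then `⌊g⌋ = u_k`, and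
`∑ cᵢ < M + d  ↔  g < 1  ↔  u_k = 0`. -/
theorem floor_g_eq_uk_and_equivalences
    (n : ℕ) (hn : 1 ≤ n) (a : Fin n → ℤ) (ha : ∀ i, 0 < a i) (b : ℤ)
    (hex : ∃ x : Fin n → ℤ, (∀ i, x i = 0 ∨ x i = 1) ∧ ∑ i, a i * x i = b)
    (t M : ℤ) (ht : 0 < t) (htM : t < M) :
    ⌊(((∑ i, (t * a i) % M) - (t * b) % M : ℤ) : ℚ) / (M : ℚ)⌋ =
      ⌊(t : ℚ) / (M : ℚ) * (((∑ i, a i) - b : ℤ) : ℚ)⌋ +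
        ⌊(t : ℚ) / (M : ℚ) * (b : ℚ)⌋ -
          ∑ i, ⌊(t : ℚ) / (M : ℚ) * (a i : ℚ)⌋ ∧
    ((∑ i, (t * a i) % M < M + (t * b) % M) ↔
      (((∑ i, (t * a i) % M) - (t * b) % M : ℤ) : ℚ) / (M : ℚ) < 1) ∧
    ((((∑ i, (t * a i) % M) - (t * b) % M : ℤ) : ℚ) / (M : ℚ) < 1 ↔
      ⌊(t : ℚ) / (M : ℚ) * (((∑ i, a i) - b : ℤ) : ℚ)⌋ +
        ⌊(t : ℚ) / (M : ℚ) * (b : ℚ)⌋ -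
          ∑ i, ⌊(t : ℚ) / (M : ℚ) * (a i : ℚ)⌋ = 0) := by
  have hM : 0 < M := ht.trans htM
  have hq : (0 : ℚ) < (M : ℚ) := by exact_mod_cast hM
  have key : ((∑ i, (t * a i) % M) - (t * b) % M) / M =
      (t * ((∑ i, a i) - b)) / M + (t * b) / M - ∑ i, (t * a i) / M := by
    have e : (∑ i, (t * a i) % M) - (t * b) % M =
        t * ((∑ i, a i) - b) + M * ((t * b) / M - ∑ i, (t * a i) / M) := by
      have h1 : ∑ i, (t * a i) % M = t * ∑ i, a i - M * ∑ i, (t * a i) / M := by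
        rw [Finset.mul_sum, Finset.mul_sum, ← Finset.sum_sub_distrib]
        exact Finset.sum_congr rfl fun i _ => Int.emod_def _ _
      rw [h1, Int.emod_def]
      ring
    rw [e, Int.add_mul_ediv_left _ _ hM.ne']
    ring
  have hnn : 0 ≤ (∑ i, (t * a i) % M) - (t * b) % M := by
    obtain ⟨x, hx, hb⟩ := hex
    have hc : ∀ i, 0 ≤ (t * a i) % M := fun i => Int.emod_nonneg _ hM.ne'
    have hmod : (t * b) % M = (∑ i, (t * a i) % M * x i) % M := by
      rw [← hb, Finset.mul_sum, Finset.sum_int_mod,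
        Finset.sum_int_mod Finset.univ M (fun i => (t * a i) % M * x i)]
      congr 1
      refine Finset.sum_congr rfl fun i _ => ?_
      rw [← mul_assoc]
      exact ((Int.mod_modEq (t * a i) M).mul_right (x i)).symm
    have h0 : 0 ≤ ∑ i, (t * a i) % M * x i := Finset.sum_nonneg fun i _ => by
      rcases hx i with h | h <;> simp [h, hc i]
    have h1 : ∑ i, (t * a i) % M * x i ≤ ∑ i, (t * a i) % M := Finset.sum_le_sum fun i _ => by
      rcases hx i with h | h <;> simp [h, hc i]
    have h2 := (Int.emod_def (∑ i, (t * a i) % M * x i) M).le.trans (sub_le_self _ (mul_nonneg hM.le (Int.ediv_nonneg h0 hM.le)))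
    linarith
  have hlt : (((∑ i, (t * a i) % M) - (t * b) % M : ℤ) : ℚ) / (M : ℚ) < 1 ↔
      (∑ i, (t * a i) % M) - (t * b) % M < M := by
    rw [div_lt_one hq, Int.cast_lt]
  have hfl : ∀ z : ℤ, ⌊(t : ℚ) / (M : ℚ) * (z : ℚ)⌋ = (t * z) / M :=
    fun z => floor_mul_aux t z M hM
  simp only [hfl, hlt, floor_div_aux _ _ hM]
  refine ⟨key, by constructor <;> intro h <;> linarith, ?_⟩
  rw [← key]
  constructor
  · intro h
    exact Int.ediv_eq_zero_of_lt hnn h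
  · intro h
    have h1 := Int.emod_lt_of_pos ((∑ i, (t * a i) % M) - (t * b) % M) hM
    rw [Int.emod_def, h] at h1
    linarith
end

section
/- Fix n ≥ 1, positive integers a_1,…,a_n and an integer b, and positive integers t < M. Set b̃ := Σ_{i=1}^n a_i − b, v_i := ⌊(t/M) a_i⌋, w := ⌊(t/M) b⌋, u := ⌊(t/M) b̃⌋ + ⌊(t/M) b⌋ − Σ_{i=1}^n ⌊(t/M) a_i⌋, and N := ⌈log₂(max(u,0) + 1)⌉. Then for every x ∈ {0,1}ⁿ: Σ_{i=1}^n a_i x_i = b if and only if there exist κ_1,…,κ_N ∈ {0,1} such that Σ_{i=1}^n a_i x_i = b and Σ_{i=1}^n v_i x_i + Σ_{j=1}^N 2^{j−1} κ_j = w. -/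
lemma floor_sum_aux {n : ℕ} (r : ℚ) (a y : Fin n → ℤ) (hy : ∀ i, y i = 0 ∨ y i = 1) :
    ∑ i, ⌊r * (a i : ℚ)⌋ * y i ≤ ⌊r * ((∑ i, a i * y i : ℤ) : ℚ)⌋ := by
  rw [Int.le_floor]
  push_cast
  rw [Finset.mul_sum]
  refine Finset.sum_le_sum fun i _ => ?_
  rcases hy i with h | h
  · simp [h]
  · simpa [h] using Int.floor_le (r * (a i : ℚ))

lemma binary_aux (N : ℕ) : ∀ k : ℤ, 0 ≤ k → k < 2 ^ N →
    ∃ κ : Fin N → ℤ, (∀ j, κ j = 0 ∨ κ j = 1) ∧ ∑ j, 2 ^ j.val * κ j = k := by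
  induction N with
  | zero =>
    intro k h0 h1
    refine ⟨fun _ => 0, fun _ => Or.inl rfl, ?_⟩
    simp at h1 ⊢
    omega
  | succ N ih =>
    intro k h0 h1
    rw [pow_succ] at h1
    obtain ⟨κ, hκ, hs⟩ := ih (k / 2) (by omega) (by omega)
    refine ⟨Fin.cons (k % 2) κ, ?_, ?_⟩
    · intro j
      refine Fin.cases ?_ (fun j => ?_) j
      · simp only [Fin.cons_zero]
        omega
      · simpa using hκ j
    · rw [Fin.sum_univ_succ]
      have h : ∑ j : Fin N, (2 : ℤ) ^ (j.succ).val * (Fin.cons (k % 2) κ : Fin (N + 1) → ℤ) j.succ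
          = 2 * (k / 2) := by
        rw [← hs, Finset.mul_sum]
        refine Finset.sum_congr rfl fun j _ => ?_
        simp only [Fin.cons_succ, Fin.val_succ, pow_succ]
        ring
      rw [h]
      simp only [Fin.cons_zero, Fin.val_zero, pow_zero, one_mul]
      omega

/-- Lemma 3.9 of the paper.
With `v_i := ⌊(t/M) aᵢ⌋`, `w := ⌊(t/M) b⌋`, `u := ⌊(t/M) b̃⌋ + ⌊(t/M) b⌋ − ∑ ⌊(t/M) aᵢ⌋`
and `N := ⌈log₂ (max u 0 + 1)⌉`, a binary vector `x` solves `∑ aᵢ xᵢ = b` iff there are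
binary `κ₁, …, κ_N` with `∑ aᵢ xᵢ = b` and `∑ vᵢ xᵢ + ∑ⱼ 2^(j-1) κⱼ = w`. -/
theorem disaggregated_system_equivalence
    (n : ℕ) (hn : 1 ≤ n) (a : Fin n → ℤ) (ha : ∀ i, 0 < a i) (b : ℤ)
    (t M : ℤ) (ht : 0 < t) (htM : t < M)
    (x : Fin n → ℤ) (hx : ∀ i, x i = 0 ∨ x i = 1) :
    (∑ i, a i * x i = b) ↔
      ∃ κ : Fin (Nat.clog 2
          ((max (⌊(t : ℚ) / (M : ℚ) * (((∑ i, a i) - b : ℤ) : ℚ)⌋ +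
              ⌊(t : ℚ) / (M : ℚ) * (b : ℚ)⌋ -
                ∑ i, ⌊(t : ℚ) / (M : ℚ) * (a i : ℚ)⌋) 0).toNat + 1)) → ℤ,
        (∀ j, κ j = 0 ∨ κ j = 1) ∧
        (∑ i, a i * x i = b) ∧
        ∑ i, ⌊(t : ℚ) / (M : ℚ) * (a i : ℚ)⌋ * x i + ∑ j, 2 ^ j.val * κ j =
          ⌊(t : ℚ) / (M : ℚ) * (b : ℚ)⌋ := by
  refine ⟨fun hb => ?_, fun ⟨_, _, h, _⟩ => h⟩
  generalize (t : ℚ) / (M : ℚ) = r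
  have h1 := floor_sum_aux r a x hx
  have h2 := floor_sum_aux r a (fun i => 1 - x i) (fun i => by rcases hx i with h | h <;> simp [h])
  simp only [mul_sub, mul_one, Finset.sum_sub_distrib] at h2
  rw [hb] at h1 h2
  set u := ⌊r * (((∑ i, a i) - b : ℤ) : ℚ)⌋ + ⌊r * (b : ℚ)⌋ - ∑ i, ⌊r * (a i : ℚ)⌋ with hu
  have h3 : (max u 0).toNat + 1 ≤ 2 ^ Nat.clog 2 ((max u 0).toNat + 1) :=
    Nat.le_pow_clog (by norm_num) _
  have h4 : (((max u 0).toNat : ℤ)) + 1 ≤ 2 ^ Nat.clog 2 ((max u 0).toNat + 1) := by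
    exact_mod_cast h3
  have h5 : u ≤ ((max u 0).toNat : ℤ) := by omega
  obtain ⟨κ, hκ, hs⟩ := binary_aux (Nat.clog 2 ((max u 0).toNat + 1))
    (⌊r * (b : ℚ)⌋ - ∑ i, ⌊r * (a i : ℚ)⌋ * x i) (by linarith) (by linarith)
  exact ⟨κ, hκ, hb, by rw [hs]; ring⟩
end

section
/- Fix n ≥ 1, positive integers a_1,…,a_n and a positive integer b with b̃ := Σ_{i=1}^n a_i − b ≥ 1. Call a real number q a jump point if q = j/a_i for some i and some integer 1 ≤ j ≤ a_i − 1, or q = j/b for some integer 1 ≤ j ≤ b − 1, or q = j/b̃ for some integer 1 ≤ j ≤ b̃ − 1. Let r_1 < r_2 be real numbers in (0,1) such that no jump point lies in the open interval (r_1, r_2). Then for every i ∈ {1,…,n}: ⌊a_i r_2⌋ − ⌊a_i r_1⌋ ∈ {0, 1}, and ⌊a_i r_2⌋ − ⌊a_i r_1⌋ = 1 if and only if a_i r_2 is an integer (equivalently, r_2 = j/a_i for some integer 1 ≤ j ≤ a_i − 1). -/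
/-- A jump point of the subset-sum problem with coefficients `a`, right-hand side `b`
and complementary right-hand side `b̃ = ∑ aᵢ − b` (Definition 3.8 of the paper). -/
def IsJumpPoint (n : ℕ) (a : Fin n → ℤ) (b : ℤ) (q : ℝ) : Prop :=
  (∃ i : Fin n, ∃ j : ℤ, 1 ≤ j ∧ j ≤ a i - 1 ∧ q = (j : ℝ) / (a i : ℝ)) ∨
  (∃ j : ℤ, 1 ≤ j ∧ j ≤ b - 1 ∧ q = (j : ℝ) / (b : ℝ)) ∨
  (∃ j : ℤ, 1 ≤ j ∧ j ≤ ((∑ i, a i) - b) - 1 ∧ q = (j : ℝ) / (((∑ i, a i) - b : ℤ) : ℝ))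

/-- Observations 3.11(a)–(c) of the paper.
If `r₁ < r₂` in `(0,1)` and no jump point lies in the open interval `(r₁, r₂)`, then for
every `i`: `⌊aᵢ r₂⌋ − ⌊aᵢ r₁⌋ ∈ {0, 1}`, and the difference equals `1` iff `aᵢ r₂` is an
integer, i.e. iff `r₂ = j / aᵢ` for some integer `1 ≤ j ≤ aᵢ − 1`. -/
theorem njp_increment_coefficients
    (n : ℕ) (hn : 1 ≤ n) (a : Fin n → ℤ) (ha : ∀ i, 0 < a i)
    (b : ℤ) (hb : 0 < b) (hbt : 1 ≤ (∑ i, a i) - b)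
    (r₁ r₂ : ℝ) (hr0 : 0 < r₁) (hr12 : r₁ < r₂) (hr1 : r₂ < 1)
    (hno : ∀ q : ℝ, r₁ < q → q < r₂ → ¬ IsJumpPoint n a b q) :
    ∀ i : Fin n,
      (⌊(a i : ℝ) * r₂⌋ - ⌊(a i : ℝ) * r₁⌋ = 0 ∨ ⌊(a i : ℝ) * r₂⌋ - ⌊(a i : ℝ) * r₁⌋ = 1) ∧
      (⌊(a i : ℝ) * r₂⌋ - ⌊(a i : ℝ) * r₁⌋ = 1 ↔
        ∃ j : ℤ, 1 ≤ j ∧ j ≤ a i - 1 ∧ r₂ = (j : ℝ) / (a i : ℝ)) := by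
  intro i
  have hai : (0 : ℝ) < (a i : ℝ) := by exact_mod_cast ha i
  have hlt : (a i : ℝ) * r₁ < (a i : ℝ) * r₂ := mul_lt_mul_of_pos_left hr12 hai
  have h1pos : 0 < (a i : ℝ) * r₁ := mul_pos hai hr0
  have h2lt : (a i : ℝ) * r₂ < (a i : ℝ) := by nlinarith
  -- no integer lies strictly between `aᵢ r₁` and `aᵢ r₂`
  have key : ∀ j : ℤ, (a i : ℝ) * r₁ < j → (a i : ℝ) * r₂ ≤ j := by
    intro j hj
    by_contra! hcon
    have hj1 : (0 : ℝ) < j := h1pos.trans hj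
    have hj2 : (j : ℝ) < (a i : ℝ) := hcon.trans h2lt
    have hj1' : 0 < j := by exact_mod_cast hj1
    have hj2' : j < a i := by exact_mod_cast hj2
    refine hno ((j : ℝ) / (a i : ℝ)) ?_ ?_ (Or.inl ⟨i, j, by omega, by omega, rfl⟩)
    · rw [lt_div_iff₀ hai]; linarith
    · rw [div_lt_iff₀ hai]; linarith
  have hk := key (⌊(a i : ℝ) * r₁⌋ + 1) (by push_cast; exact Int.lt_floor_add_one _)
  have hmono : ⌊(a i : ℝ) * r₁⌋ ≤ ⌊(a i : ℝ) * r₂⌋ := Int.floor_le_floor hlt.le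
  have hup : ⌊(a i : ℝ) * r₂⌋ ≤ ⌊(a i : ℝ) * r₁⌋ + 1 := by
    have := (Int.floor_le ((a i : ℝ) * r₂)).trans hk
    exact_mod_cast this
  refine ⟨by omega, ?_, ?_⟩
  · intro h
    have he : ⌊(a i : ℝ) * r₂⌋ = ⌊(a i : ℝ) * r₁⌋ + 1 := by omega
    rw [← he] at hk
    have heq : (a i : ℝ) * r₂ = (⌊(a i : ℝ) * r₂⌋ : ℝ) := le_antisymm hk (Int.floor_le _)
    have hp : (0 : ℝ) < (⌊(a i : ℝ) * r₂⌋ : ℝ) := by rw [← heq]; linarith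
    have hq : (⌊(a i : ℝ) * r₂⌋ : ℝ) < (a i : ℝ) := by rw [← heq]; exact h2lt
    have hp' : 0 < ⌊(a i : ℝ) * r₂⌋ := by exact_mod_cast hp
    have hq' : ⌊(a i : ℝ) * r₂⌋ < a i := by exact_mod_cast hq
    refine ⟨⌊(a i : ℝ) * r₂⌋, by omega, by omega, ?_⟩
    rw [eq_div_iff hai.ne']
    linarith
  · rintro ⟨j, -, -, hj⟩
    have heq : (a i : ℝ) * r₂ = (j : ℝ) := by
      rw [hj]; field_simp
    have hf : ⌊(a i : ℝ) * r₂⌋ = j := by rw [heq]; exact Int.floor_intCast j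
    have hlt' : ⌊(a i : ℝ) * r₁⌋ < j := by
      rw [Int.floor_lt, ← heq]; exact hlt
    omega
end
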